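/- arXiv:1501.03976 — 2 statements merged into one kernel-verified Lean document; each statement's English description precedes it below -/
import Mathlib

section
/- Fix an integer k ≥ 0 and let C := ∫₀¹ 4t²/√(1−t⁴) dt. Define g_k : [0,1) → ℝ by g_k(z) := 2z·(kC + 2∫_z¹ t²/√(1−t⁴) dt). Then g_k(0) = 0, g_k(z) → 2kC as z → 1⁻, and g_k is strictly concave on (0,1), i.e. its derivative g_k'(z) = 2kC + 4∫_z¹ t²/√(1−t⁴) dt − 4z³/√(1−z⁴) is strictly decreasing on (0,1). Moreover sup_{z∈[0,1)} g_k(z) = M_k, where M_k := sup_{z∈[0,1]} 2z·(kC + 2∫_z¹ t²/√(1−t⁴) dt). -/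
/-- The integrand `t² / √(1 - t⁴)` is integrable on `[0, 1]`, despite its singularity at `1`. -/
lemma intervalIntegrable_sq_div_sqrt_one_sub_pow_four :
    IntervalIntegrable (fun t : ℝ => t ^ 2 / Real.sqrt (1 - t ^ 4)) MeasureTheory.volume 0 1 := by
  have hbound : IntervalIntegrable (fun t : ℝ => (1 - t) ^ (-(1 / 2) : ℝ))
      MeasureTheory.volume 0 1 := by
    simpa using ((intervalIntegral.intervalIntegrable_rpow' (a := 0) (b := 1)
      (r := -(1 / 2)) (by norm_num)).comp_sub_left 1).symm
  refine hbound.mono_fun' (Measurable.aestronglyMeasurable (by fun_prop)) ?_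
  refine (MeasureTheory.ae_restrict_mem measurableSet_uIoc).mono fun t ht => ?_
  rw [Set.uIoc_of_le zero_le_one] at ht
  obtain ⟨h0, h1⟩ := ht
  have hnn : 0 ≤ 1 - t := by linarith
  have hr : (1 - t) ^ (-(1 / 2) : ℝ) = 1 / Real.sqrt (1 - t) := by
    rw [Real.rpow_neg hnn, ← Real.sqrt_eq_rpow, one_div]
  simp only [hr]
  rw [Real.norm_of_nonneg (by positivity)]
  rcases h1.eq_or_lt with rfl | h1
  · simp
  have h4 : t ^ 4 ≤ t := pow_le_of_le_one h0.le h1.le (by norm_num)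
  have hpos : 0 < Real.sqrt (1 - t) := Real.sqrt_pos.2 (by linarith)
  gcongr
  exact pow_le_one₀ h0.le h1.le

lemma strictMonoOn_pow_three_div_sqrt_one_sub_pow_four :
    StrictMonoOn (fun z : ℝ => z ^ 3 / Real.sqrt (1 - z ^ 4)) (Set.Ico 0 1) := by
  intro x hx y hy hxy
  have hy0 : 0 < y := hx.1.trans_lt hxy
  have h4 : y ^ 4 < 1 := pow_lt_one₀ hy0.le hy.2 (by norm_num)
  have hle : x ^ 4 ≤ y ^ 4 := pow_le_pow_left₀ hx.1 hxy.le 4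
  have hlt : x ^ 3 < y ^ 3 := pow_lt_pow_left₀ hxy hx.1 (by norm_num)
  have hpos : 0 < Real.sqrt (1 - y ^ 4) := Real.sqrt_pos.2 (by linarith)
  exact div_lt_div₀ hlt (Real.sqrt_le_sqrt (by linarith)) (by positivity) hpos

/-- Properties of the function `g_k(z) := 2z(kC + 2∫_z¹ t²/√(1−t⁴) dt)` on `[0,1)`:
`g_k(0) = 0`, `g_k(z) → 2kC` as `z → 1⁻`, `g_k` is strictly concave on `(0,1)` with
derivative `g_k'(z) = 2kC + 4∫_z¹ t²/√(1−t⁴) dt − 4z³/√(1−z⁴)` strictly decreasing on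
`(0,1)`, and `sup_{z∈[0,1)} g_k(z) = M_k`. -/
theorem willmore_g_function_properties
    (k : ℕ)
    (C : ℝ) (hC : C = ∫ t in (0 : ℝ)..1, 4 * t ^ 2 / Real.sqrt (1 - t ^ 4))
    (M : ℝ)
    (hM : M = sSup ((fun z : ℝ =>
      2 * z * (k * C + 2 * ∫ t in z..1, t ^ 2 / Real.sqrt (1 - t ^ 4))) ''
        Set.Icc (0 : ℝ) 1))
    (g g' : ℝ → ℝ)
    (hg : ∀ z : ℝ, g z = 2 * z * (k * C + 2 * ∫ t in z..1, t ^ 2 / Real.sqrt (1 - t ^ 4)))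
    (hg' : ∀ z : ℝ, g' z = 2 * k * C + (4 * ∫ t in z..1, t ^ 2 / Real.sqrt (1 - t ^ 4))
      - 4 * z ^ 3 / Real.sqrt (1 - z ^ 4)) :
    g 0 = 0 ∧
      Filter.Tendsto g (nhdsWithin 1 (Set.Iio 1)) (nhds (2 * k * C)) ∧
      StrictConcaveOn ℝ (Set.Ioo (0 : ℝ) 1) g ∧
      (∀ z ∈ Set.Ioo (0 : ℝ) 1, HasDerivAt g (g' z) z) ∧
      StrictAntiOn g' (Set.Ioo (0 : ℝ) 1) ∧
      sSup (g '' Set.Ico (0 : ℝ) 1) = M := by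
  set f : ℝ → ℝ := fun t => t ^ 2 / Real.sqrt (1 - t ^ 4) with hf
  have hint : IntervalIntegrable f MeasureTheory.volume 0 1 :=
    intervalIntegrable_sq_div_sqrt_one_sub_pow_four
  have hint_right {z : ℝ} (hz : z ∈ Set.Icc (0 : ℝ) 1) :
      IntervalIntegrable f MeasureTheory.volume z 1 :=
    hint.mono_set (Set.uIcc_subset_uIcc (by simpa using hz) Set.right_mem_uIcc)
  have hcont : ContinuousOn g (Set.Icc 0 1) := by
    have hprim : ContinuousOn (fun z => ∫ t in z..1, f t) (Set.Icc 0 1) := by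
      have h := intervalIntegral.continuousOn_primitive_interval_left
        (f := f) (μ := MeasureTheory.volume) (a := 0) (b := 1) ?_
      · rwa [Set.uIcc_of_le zero_le_one] at h
      · rwa [Set.uIcc_of_le zero_le_one, ← intervalIntegrable_iff_integrableOn_Icc_of_le zero_le_one]
    rw [show g = _ from funext hg]
    fun_prop
  have hderiv : ∀ z ∈ Set.Ioo (0 : ℝ) 1, HasDerivAt g (g' z) z := by
    intro z hz
    have h4 : 0 < 1 - z ^ 4 := by
      linarith [pow_lt_one₀ hz.1.le hz.2 (show (4 : ℕ) ≠ 0 by norm_num)]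
    have hfc : ContinuousAt f z := by
      have : Real.sqrt (1 - z ^ 4) ≠ 0 := (Real.sqrt_pos.2 h4).ne'
      fun_prop (disch := assumption)
    have hprim : HasDerivAt (fun z => ∫ t in z..1, f t) (-f z) z :=
      intervalIntegral.integral_hasDerivAt_left (hint_right ⟨hz.1.le, hz.2.le⟩)
        (Measurable.stronglyMeasurable (by fun_prop)).stronglyMeasurableAtFilter hfc
    rw [show g = _ from funext hg]
    refine (((hasDerivAt_id z).const_mul 2).mul
      ((hprim.const_mul 2).const_add (k * C))).congr_deriv ?_
    rw [hg' z]
    simp only [hf, id]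
    ring
  have hanti : StrictAntiOn g' (Set.Ioo 0 1) := by
    intro x hx y hy hxy
    have hsplit : (∫ t in x..y, f t) + ∫ t in y..1, f t = ∫ t in x..1, f t :=
      intervalIntegral.integral_add_adjacent_intervals
        (hint.mono_set (Set.uIcc_subset_uIcc (by simpa using ⟨hx.1.le, hx.2.le⟩)
          (by simpa using ⟨hy.1.le, hy.2.le⟩))) (hint_right ⟨hy.1.le, hy.2.le⟩)
    have hnn : 0 ≤ ∫ t in x..y, f t :=
      intervalIntegral.integral_nonneg hxy.le fun t _ => by positivity
    have hmono := strictMonoOn_pow_three_div_sqrt_one_sub_pow_four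
      (Set.Ioo_subset_Ico_self hx) (Set.Ioo_subset_Ico_self hy) hxy
    simp only [mul_div_assoc] at hmono hg'
    rw [hg', hg']
    linarith
  refine ⟨by simp [hg], ?_, ?_, hderiv, hanti, ?_⟩
  · have h := (hcont 1 (by simp)).mono Set.Ico_subset_Icc_self
    rw [ContinuousWithinAt, nhdsWithin_Ico_eq_nhdsLT zero_lt_one] at h
    convert h using 2
    simp [hg, mul_assoc]
  · refine StrictAntiOn.strictConcaveOn_of_deriv (convex_Ioo 0 1)
      (hcont.mono Set.Ioo_subset_Icc_self) ?_
    rw [interior_Ioo]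
    exact hanti.congr fun z hz => (hderiv z hz).deriv.symm
  · have hclosure : closure (g '' Set.Ico 0 1) = g '' Set.Icc 0 1 := by
      refine (closure_minimal (Set.image_mono Set.Ico_subset_Icc_self)
        (isCompact_Icc.image_of_continuousOn hcont).isClosed).antisymm ?_
      have h : closure (Set.Ico (0 : ℝ) 1) = Set.Icc 0 1 := closure_Ico zero_ne_one
      rw [← h]
      exact ContinuousOn.image_closure (h ▸ hcont)
    have hbdd : BddAbove (g '' Set.Icc 0 1) :=
      (isCompact_Icc.image_of_continuousOn hcont).bddAbove
    have hlub := isLUB_csSup (Set.image_nonempty.2 (Set.nonempty_Ico.2 (zero_lt_one' ℝ)))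
      (hbdd.mono (Set.image_mono Set.Ico_subset_Icc_self))
    rw [hM, ← show g = _ from funext hg, ← hclosure]
    exact (((isLUB_iff_of_subset_of_subset_closure subset_closure le_rfl).1 hlub).csSup_eq
      (by simp)).symm
end

section
/- Fix an integer k ≥ 1, let C := ∫₀¹ 4t²/√(1−t⁴) dt and M_k := sup_{z∈[0,1]} 2z·(kC + 2∫_z¹ t²/√(1−t⁴) dt), and define g_k : [0,1) → ℝ by g_k(z) := 2z·(kC + 2∫_z¹ t²/√(1−t⁴) dt). Then for every m ≥ 0 the set {z ∈ [0,1) : g_k(z) = m} has exactly one element if 0 ≤ m ≤ 2kC, exactly two elements if 2kC < m < M_k, exactly one element if m = M_k, and is empty if m > M_k. -/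
open Set MeasureTheory

/-- A continuous strictly concave function on `[0, 1]` whose maximum is not attained at the
endpoints is strictly increasing up to an interior maximum point and strictly decreasing after. -/
lemma StrictConcaveOn.exists_strictMonoOn_strictAntiOn {g : ℝ → ℝ} {a b w : ℝ}
    (hc : ContinuousOn g (Icc a b)) (hs : StrictConcaveOn ℝ (Icc a b) g)
    (hw : w ∈ Icc a b) (ha : g a < g w) (hb : g b < g w) :
    ∃ p ∈ Ioo a b, IsMaxOn g (Icc a b) p ∧ StrictMonoOn g (Icc a p) ∧
      StrictAntiOn g (Icc p b) := by
  obtain ⟨p, hp, hmax⟩ := isCompact_Icc.exists_isMaxOn ⟨w, hw⟩ hc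
  have hwp : g w ≤ g p := hmax hw
  have hpa : a < p := hp.1.lt_of_ne (by rintro rfl; linarith)
  have hpb : p < b := hp.2.lt_of_ne (by rintro rfl; linarith)
  have hlt : ∀ x ∈ Icc a b, x ≠ p → g x < g p := by
    intro x hx hxp
    refine (hmax hx : g x ≤ g p).lt_of_ne fun h => hxp ?_
    refine hs.eq_of_isMaxOn (fun y hy => ?_) hmax hx hp
    exact (hmax hy : g y ≤ g p).trans_eq h.symm
  refine ⟨p, ⟨hpa, hpb⟩, hmax, ?_, ?_⟩
  · intro x hx y hy hxy
    have hxI : x ∈ Icc a b := ⟨hx.1, hx.2.trans hp.2⟩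
    have hxp := hlt x hxI (hxy.trans_le hy.2).ne
    rcases hy.2.eq_or_lt with rfl | hyp
    · exact hxp
    · have := hs.lt_on_openSegment hxI hp (hxy.trans hyp).ne
        (z := y) (by rw [openSegment_eq_Ioo (hxy.trans hyp)]; exact ⟨hxy, hyp⟩)
      rwa [min_eq_left hxp.le] at this
  · intro x hx y hy hxy
    have hyI : y ∈ Icc a b := ⟨hp.1.trans hy.1, hy.2⟩
    have hyp := hlt y hyI (hx.1.trans_lt hxy).ne'
    rcases hx.1.eq_or_lt with rfl | hpx
    · exact hyp
    · have := hs.lt_on_openSegment hp hyI (hpx.trans hxy).ne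
        (z := x) (by rw [openSegment_eq_Ioo (hpx.trans hxy)]; exact ⟨hpx, hxy⟩)
      rwa [min_eq_right hyp.le] at this

lemma one_sub_pow_four_pos {t : ℝ} (h0 : 0 ≤ t) (h1 : t < 1) : 0 < 1 - t ^ 4 :=
  sub_pos.2 (pow_lt_one₀ h0 h1 (by norm_num))

lemma sq_div_sqrt_nonneg (t : ℝ) : 0 ≤ t ^ 2 / Real.sqrt (1 - t ^ 4) := by positivity

lemma continuousOn_sq_div_sqrt :
    ContinuousOn (fun t : ℝ => t ^ 2 / Real.sqrt (1 - t ^ 4)) (Ioo 0 1) := by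
  refine ContinuousOn.div (by fun_prop) (by fun_prop) fun t ht => ?_
  exact (Real.sqrt_pos.2 (one_sub_pow_four_pos ht.1.le ht.2)).ne'

lemma monotoneOn_sq_div_sqrt :
    MonotoneOn (fun t : ℝ => t ^ 2 / Real.sqrt (1 - t ^ 4)) (Ico 0 1) := by
  intro x hx y hy hxy
  have hx0 := hx.1
  have := Real.sqrt_pos.2 (one_sub_pow_four_pos hy.1 hy.2)
  dsimp only
  gcongr

lemma strictMonoOn_mul_sq_div_sqrt :
    StrictMonoOn (fun t : ℝ => t * (t ^ 2 / Real.sqrt (1 - t ^ 4))) (Ioo 0 1) := by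
  intro x hx y hy hxy
  refine mul_lt_mul hxy (monotoneOn_sq_div_sqrt ⟨hx.1.le, hx.2⟩ ⟨hy.1.le, hy.2⟩ hxy.le) ?_ hy.1.le
  exact div_pos (pow_pos hx.1 2) (Real.sqrt_pos.2 (one_sub_pow_four_pos hx.1.le hx.2))

lemma intervalIntegrable_sq_div_sqrt :
    IntervalIntegrable (fun t : ℝ => t ^ 2 / Real.sqrt (1 - t ^ 4)) volume 0 1 := by
  have h1 : IntervalIntegrable (fun t : ℝ => (1 - t) ^ (-(1 / 2) : ℝ)) volume 0 1 := by
    have := (intervalIntegral.intervalIntegrable_rpow' (a := 0) (b := 1)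
      (r := -(1 / 2)) (by norm_num)).comp_sub_left 1
    simpa using this.symm
  rw [intervalIntegrable_iff_integrableOn_Ioo_of_le zero_le_one] at h1 ⊢
  refine h1.mono' (continuousOn_sq_div_sqrt.aestronglyMeasurable measurableSet_Ioo) ?_
  refine (ae_restrict_iff' measurableSet_Ioo).2 (ae_of_all _ fun t ht => ?_)
  have ht1 : 0 < 1 - t := sub_pos.2 ht.2
  have h4 : t ^ 4 ≤ t := pow_le_of_le_one ht.1.le ht.2.le (by norm_num)
  rw [Real.norm_of_nonneg (sq_div_sqrt_nonneg t), Real.rpow_neg ht1.le, ← Real.sqrt_eq_rpow,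
    ← one_div]
  have := Real.sqrt_pos.2 ht1
  gcongr
  exact pow_le_one₀ ht.1.le ht.2.le

lemma intervalIntegrable_sq_div_sqrt_of_mem {z : ℝ} (hz : z ∈ Icc (0 : ℝ) 1) :
    IntervalIntegrable (fun t : ℝ => t ^ 2 / Real.sqrt (1 - t ^ 4)) volume z 1 :=
  intervalIntegrable_sq_div_sqrt.mono_set (by
    rw [uIcc_of_le hz.2, uIcc_of_le zero_le_one]; exact Icc_subset_Icc_left hz.1)

lemma hasDerivAt_integral_sq_div_sqrt {z : ℝ} (hz : z ∈ Ioo (0 : ℝ) 1) :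
    HasDerivAt (fun z : ℝ => ∫ t in z..1, t ^ 2 / Real.sqrt (1 - t ^ 4))
      (-(z ^ 2 / Real.sqrt (1 - z ^ 4))) z :=
  intervalIntegral.integral_hasDerivAt_left
    (intervalIntegrable_sq_div_sqrt_of_mem (Ioo_subset_Icc_self hz))
    (continuousOn_sq_div_sqrt.stronglyMeasurableAtFilter isOpen_Ioo z hz)
    (continuousOn_sq_div_sqrt.continuousAt (isOpen_Ioo.mem_nhds hz))

lemma continuousOn_integral_sq_div_sqrt :
    ContinuousOn (fun z : ℝ => ∫ t in z..1, t ^ 2 / Real.sqrt (1 - t ^ 4)) (Icc 0 1) := by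
  have := intervalIntegral.continuousOn_primitive_interval_left (μ := volume) (a := 0) (b := 1)
    (f := fun t : ℝ => t ^ 2 / Real.sqrt (1 - t ^ 4)) (by
      rw [uIcc_of_le zero_le_one, ← intervalIntegrable_iff_integrableOn_Icc_of_le zero_le_one]
      exact intervalIntegrable_sq_div_sqrt)
  rwa [uIcc_of_le zero_le_one] at this

lemma le_integral_sq_div_sqrt {w : ℝ} (hw : w ∈ Ioo (0 : ℝ) 1) :
    (1 - w) * (w ^ 2 / Real.sqrt (1 - w ^ 4)) ≤ ∫ t in w..1, t ^ 2 / Real.sqrt (1 - t ^ 4) := by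
  have h := intervalIntegral.integral_mono_on_of_le_Ioo (μ := volume) hw.2.le
    (intervalIntegrable_const (c := w ^ 2 / Real.sqrt (1 - w ^ 4)))
    (intervalIntegrable_sq_div_sqrt_of_mem (Ioo_subset_Icc_self hw)) fun t ht =>
      monotoneOn_sq_div_sqrt ⟨hw.1.le, hw.2⟩ ⟨(hw.1.trans ht.1).le, ht.2⟩ ht.1.le
  rwa [intervalIntegral.integral_const, smul_eq_mul] at h

lemma exists_lt_mul_sq_div_sqrt {A : ℝ} (hA : 0 ≤ A) :
    ∃ w ∈ Ioo (0 : ℝ) 1, A < 2 * (w * (w ^ 2 / Real.sqrt (1 - w ^ 4))) := by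
  set e : ℝ := 1 / (A + 2) with he
  have he0 : 0 < e := by positivity
  have he1 : e ≤ 1 / 2 := by rw [he]; gcongr; linarith
  have hAe : A * e = 1 - 2 * e := by rw [he]; field_simp; ring
  have hs : 0 < 1 - e ^ 2 := by nlinarith
  have hw0 : 0 < Real.sqrt (Real.sqrt (1 - e ^ 2)) := Real.sqrt_pos.2 (Real.sqrt_pos.2 hs)
  set w := Real.sqrt (Real.sqrt (1 - e ^ 2)) with hw
  have hw4 : w ^ 4 = 1 - e ^ 2 := by
    rw [show w ^ 4 = (w ^ 2) ^ 2 by ring, hw, Real.sq_sqrt (Real.sqrt_nonneg _),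
      Real.sq_sqrt hs.le]
  have hw1 : w < 1 := by
    by_contra! h
    have := one_le_pow₀ h (n := 4)
    nlinarith
  refine ⟨w, ⟨hw0, hw1⟩, ?_⟩
  have h3 : w ^ 4 ≤ w ^ 3 := pow_le_pow_of_le_one hw0.le hw1.le (by norm_num)
  rw [show 1 - w ^ 4 = e ^ 2 by rw [hw4]; ring, Real.sqrt_sq he0.le,
    show 2 * (w * (w ^ 2 / e)) = 2 * w ^ 3 / e by ring, lt_div_iff₀ he0]
  nlinarith

lemma strictConcaveOn_mul_add_integral_sq_div_sqrt (A : ℝ) :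
    StrictConcaveOn ℝ (Icc 0 1)
      (fun z : ℝ => 2 * z * (A + 2 * ∫ t in z..1, t ^ 2 / Real.sqrt (1 - t ^ 4))) := by
  refine StrictAntiOn.strictConcaveOn_of_deriv (convex_Icc 0 1) ?_ ?_
  · exact ContinuousOn.mul (by fun_prop)
      (continuousOn_const.add (continuousOn_const.mul continuousOn_integral_sq_div_sqrt))
  rw [interior_Icc]
  have hd : ∀ z ∈ Ioo (0 : ℝ) 1, deriv (fun z : ℝ =>
      2 * z * (A + 2 * ∫ t in z..1, t ^ 2 / Real.sqrt (1 - t ^ 4))) z =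
      2 * A + 4 * (∫ t in z..1, t ^ 2 / Real.sqrt (1 - t ^ 4)) -
        4 * (z * (z ^ 2 / Real.sqrt (1 - z ^ 4))) := by
    intro z hz
    refine HasDerivAt.deriv ?_
    refine (((hasDerivAt_id' z).const_mul 2).mul
      (((hasDerivAt_integral_sq_div_sqrt hz).const_mul 2).const_add A)).congr_deriv ?_
    ring
  intro x hx y hy hxy
  rw [hd x hx, hd y hy]
  have h1 : x * (x ^ 2 / Real.sqrt (1 - x ^ 4)) < y * (y ^ 2 / Real.sqrt (1 - y ^ 4)) :=
    strictMonoOn_mul_sq_div_sqrt hx hy hxy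
  have h2 : (∫ t in y..1, t ^ 2 / Real.sqrt (1 - t ^ 4)) ≤
      ∫ t in x..1, t ^ 2 / Real.sqrt (1 - t ^ 4) :=
    intervalIntegral.integral_mono_interval hxy.le hy.2.le le_rfl
      (ae_of_all _ sq_div_sqrt_nonneg)
      (intervalIntegrable_sq_div_sqrt_of_mem (Ioo_subset_Icc_self hx))
  linarith


/-- Let `k ≥ 1`, `C := ∫₀¹ 4t²/√(1−t⁴) dt`, `M_k := sup_{z∈[0,1]} g_k(z)` where
`g_k(z) := 2z(kC + 2∫_z¹ t²/√(1−t⁴) dt)`. For every `m ≥ 0` the equation `g_k(z) = m`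
has exactly one solution in `[0,1)` if `0 ≤ m ≤ 2kC`, exactly two if `2kC < m < M_k`,
exactly one if `m = M_k`, and none if `m > M_k`. -/
theorem willmore_gk_level_sets
    (k : ℕ) (hk : 1 ≤ k)
    (C : ℝ) (hC : C = ∫ t in (0 : ℝ)..1, 4 * t ^ 2 / Real.sqrt (1 - t ^ 4))
    (M : ℝ)
    (hM : M = sSup ((fun z : ℝ =>
      2 * z * (k * C + 2 * ∫ t in z..1, t ^ 2 / Real.sqrt (1 - t ^ 4))) ''
        Set.Icc (0 : ℝ) 1))
    (g : ℝ → ℝ)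
    (hg : ∀ z : ℝ, g z = 2 * z * (k * C + 2 * ∫ t in z..1, t ^ 2 / Real.sqrt (1 - t ^ 4))) :
    ∀ m : ℝ, 0 ≤ m →
      ((m ≤ 2 * k * C → {z ∈ Set.Ico (0 : ℝ) 1 | g z = m}.ncard = 1) ∧
       (2 * k * C < m → m < M → {z ∈ Set.Ico (0 : ℝ) 1 | g z = m}.ncard = 2) ∧
       (m = M → {z ∈ Set.Ico (0 : ℝ) 1 | g z = m}.ncard = 1) ∧
       (M < m → {z ∈ Set.Ico (0 : ℝ) 1 | g z = m} = ∅)) := by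
  have hC0 : 0 ≤ C := by
    rw [hC]
    exact intervalIntegral.integral_nonneg zero_le_one fun t _ => by positivity
  have hA : (0 : ℝ) ≤ k * C := by positivity
  have hgM : M = sSup (g '' Icc 0 1) := by rw [hM, funext hg]
  have hs : StrictConcaveOn ℝ (Icc 0 1) g := by
    rw [funext hg]; exact strictConcaveOn_mul_add_integral_sq_div_sqrt _
  have hc : ContinuousOn g (Icc 0 1) := by
    rw [funext hg]
    exact ContinuousOn.mul (by fun_prop)
      (continuousOn_const.add (continuousOn_const.mul continuousOn_integral_sq_div_sqrt))
  have hg0 : g 0 = 0 := by simp [hg]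
  have hg1 : g 1 = 2 * k * C := by simp [hg]; ring
  obtain ⟨w, hw, hAw⟩ := exists_lt_mul_sq_div_sqrt hA
  have hg1w : g 1 < g w := by
    rw [hg1, hg w]
    have h1 := mul_le_mul_of_nonneg_left (le_integral_sq_div_sqrt hw) hw.1.le
    have h2 := mul_lt_mul_of_pos_left hAw (sub_pos.2 hw.2)
    linarith
  have hg01 : g 0 ≤ g 1 := by rw [hg0, hg1]; linarith
  obtain ⟨p, hp, hmax, hmono, hanti⟩ := hs.exists_strictMonoOn_strictAntiOn hc
    (Ioo_subset_Icc_self hw) (hg01.trans_lt hg1w) hg1w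
  have hpI := Ioo_subset_Icc_self hp
  have hMp : M = g p := by
    rw [hgM]
    exact IsGreatest.csSup_eq ⟨mem_image_of_mem g hpI, forall_mem_image.2 hmax⟩
  have hg1p : g 1 < g p := hg1w.trans_le (hmax (Ioo_subset_Icc_self hw))
  have hleft : ∀ m, 0 ≤ m → m < g p → ∃ a ∈ Ico 0 p, g a = m := fun m hm hmp =>
    intermediate_value_Ico hp.1.le (hc.mono (Icc_subset_Icc_right hp.2.le)) ⟨hg0.trans_le hm, hmp⟩
  have hright : ∀ m, g 1 < m → m < g p → ∃ b ∈ Ioo p 1, g b = m := fun m hm hmp =>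
    intermediate_value_Ioo' hp.2.le (hc.mono (Icc_subset_Icc_left hp.1.le)) ⟨hm, hmp⟩
  rw [← hg1, hMp]
  intro m hm
  refine ⟨fun h => ?_, fun h h' => ?_, fun h => ?_, fun h => ?_⟩
  · obtain ⟨a, ha, rfl⟩ := hleft m hm (h.trans_lt hg1p)
    refine ncard_eq_one.2 ⟨a, Subset.antisymm ?_ ?_⟩
    · rintro z ⟨hz, hza⟩
      rcases le_total z p with hzp | hpz
      · exact hmono.injOn ⟨hz.1, hzp⟩ ⟨ha.1, ha.2.le⟩ hza
      · have := hanti ⟨hpz, hz.2.le⟩ ⟨hp.2.le, le_rfl⟩ hz.2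
        linarith
    · rintro _ rfl
      exact ⟨⟨ha.1, ha.2.trans hp.2⟩, rfl⟩
  · obtain ⟨a, ha, rfl⟩ := hleft m hm h'
    obtain ⟨b, hb, hba⟩ := hright (g a) h h'
    refine ncard_eq_two.2 ⟨a, b, (ha.2.trans hb.1).ne, Subset.antisymm ?_ ?_⟩
    · rintro z ⟨hz, hza⟩
      rcases le_total z p with hzp | hpz
      · exact Or.inl (hmono.injOn ⟨hz.1, hzp⟩ ⟨ha.1, ha.2.le⟩ hza)
      · exact Or.inr (hanti.injOn ⟨hpz, hz.2.le⟩ ⟨hb.1.le, hb.2.le⟩ (hza.trans hba.symm))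
    · rintro _ (rfl | rfl)
      · exact ⟨⟨ha.1, ha.2.trans hp.2⟩, rfl⟩
      · exact ⟨⟨(hp.1.trans hb.1).le, hb.2⟩, hba⟩
  · subst h
    refine ncard_eq_one.2 ⟨p, Subset.antisymm ?_ ?_⟩
    · rintro z ⟨hz, hzp⟩
      rcases le_total z p with h | h
      · exact hmono.injOn ⟨hz.1, h⟩ ⟨hp.1.le, le_rfl⟩ hzp
      · exact hanti.injOn ⟨h, hz.2.le⟩ ⟨le_rfl, hp.2.le⟩ hzp
    · rintro _ rfl
      exact ⟨⟨hp.1.le, hp.2⟩, rfl⟩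
  · refine eq_empty_of_forall_notMem fun z hz => ?_
    have : g z ≤ g p := hmax (Ico_subset_Icc_self hz.1)
    linarith [hz.2]
end
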